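/- Let n ≥ 1. Let S be the polynomial ring over ℂ in the 2n² variables x_{ij}, y_{ij} (1 ≤ i, j ≤ n), X and Y the generic n×n matrices over S, and I ⊆ S the ideal generated by the n² entries of X·Y − Y·X. Then the Krull dimension of S/I equals n² + n. -/

import Mathlib

open MvPolynomial


/-- The generic `n × n` matrix `X` (first copy of variables). -/
noncomputable def genX (n : ℕ) :
    Matrix (Fin n) (Fin n) (MvPolynomial ((Fin n × Fin n) ⊕ (Fin n × Fin n)) ℂ) :=
  Matrix.of fun i j => MvPolynomial.X (Sum.inl (i, j))

/-- The generic `n × n` matrix `Y` (second copy of variables). -/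
noncomputable def genY (n : ℕ) :
    Matrix (Fin n) (Fin n) (MvPolynomial ((Fin n × Fin n) ⊕ (Fin n × Fin n)) ℂ) :=
  Matrix.of fun i j => MvPolynomial.X (Sum.inr (i, j))


theorem aux_coheight_le {R B : Type*} [CommRing R] [CommRing B] [Algebra R B]
    [Algebra.IsIntegral R B] (k : ℕ) : ∀ P : PrimeSpectrum B,
    (k : ℕ∞) ≤ Order.coheight (PrimeSpectrum.comap (algebraMap R B) P) →
    (k : ℕ∞) ≤ Order.coheight P := by
  induction k with
  | zero => intro P _; simp
  | succ k ih =>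
    intro P h
    by_contra hc
    have hc' : Order.coheight P ≤ k := by
      rw [not_le] at hc
      push_cast at hc
      exact Order.lt_add_one_iff_of_not_isMax (by simp) |>.mp hc
    have h2 : ¬ Order.coheight (PrimeSpectrum.comap (algebraMap R B) P) ≤ k := by
      intro h3
      have := h.trans h3
      norm_cast at this
      omega
    rw [Order.coheight_le_coe_iff] at hc' h2
    push Not at h2
    obtain ⟨y, hy, hky⟩ := h2
    obtain ⟨Q, hQP, hQ, hQy⟩ := Ideal.exists_ideal_over_prime_of_isIntegral y.asIdeal P.asIdeal
      (show (PrimeSpectrum.comap (algebraMap R B) P).asIdeal ≤ y.asIdeal from le_of_lt hy)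
    have hcomap : PrimeSpectrum.comap (algebraMap R B) ⟨Q, hQ⟩ = y := PrimeSpectrum.ext hQy
    have hlt : P < ⟨Q, hQ⟩ := by
      refine lt_of_le_of_ne hQP ?_
      intro he
      rw [he, hcomap] at hy
      exact lt_irrefl _ hy
    have := ih ⟨Q, hQ⟩ (by rw [hcomap]; exact hky)
    exact absurd (hc' _ hlt) (not_lt.mpr this)

theorem aux_dim_le_of_integral {R B : Type*} [CommRing R] [CommRing B] [Algebra R B]
    [Algebra.IsIntegral R B] : ringKrullDim B ≤ ringKrullDim R := by
  refine Order.krullDim_le_of_strictMono (PrimeSpectrum.comap (algebraMap R B)) ?_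
  intro P Q h
  exact Ideal.IsIntegral.comap_lt_comap (R := R) (I := P.asIdeal) (J := Q.asIdeal) h

theorem aux_le_dim_of_integral {R B : Type*} [CommRing R] [CommRing B] [Algebra R B]
    [Algebra.IsIntegral R B] (hinj : Function.Injective (algebraMap R B)) :
    ringKrullDim R ≤ ringKrullDim B := by
  unfold ringKrullDim
  rw [Order.krullDim_eq_iSup_coheight (α := PrimeSpectrum R)]
  refine iSup_le fun p => ?_
  obtain ⟨Q, hQP, hQ, hQy⟩ := Ideal.exists_ideal_over_prime_of_isIntegral p.asIdeal (⊥ : Ideal B)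
      (by rw [← RingHom.ker_eq_comap_bot, (RingHom.injective_iff_ker_eq_bot _).mp hinj]; exact bot_le)
  have hcomap : PrimeSpectrum.comap (algebraMap R B) ⟨Q, hQ⟩ = p := PrimeSpectrum.ext hQy
  refine le_trans ?_ (Order.coheight_le_krullDim (⟨Q, hQ⟩ : PrimeSpectrum B))
  rw [WithBot.coe_le_coe]
  refine ENat.forall_natCast_le_iff_le.mp fun k hk => ?_
  exact aux_coheight_le (R := R) k _ (by rw [hcomap]; exact hk)

theorem aux_dim_le {k A : Type} [Field k] [CommRing A] [Algebra k A] [Algebra.FiniteType k A]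
    (m : ℕ) (h : ∀ P : Ideal A, P.IsPrime → Algebra.trdeg k (A ⧸ P) ≤ m) :
    ringKrullDim A ≤ m := by
  rcases subsingleton_or_nontrivial A with hA | hA
  · rw [ringKrullDim_eq_bot_of_subsingleton]; exact bot_le
  obtain ⟨s, g, hg, hgi⟩ := exists_integral_inj_algHom_of_fg k A
  let : Algebra (MvPolynomial (Fin s) k) A := g.toRingHom.toAlgebra
  have : Algebra.IsIntegral (MvPolynomial (Fin s) k) A := ⟨hgi⟩
  have h1 : ringKrullDim A ≤ ringKrullDim (MvPolynomial (Fin s) k) := aux_dim_le_of_integral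
  rw [MvPolynomial.ringKrullDim_of_isNoetherianRing, ringKrullDim_eq_zero_of_field] at h1
  refine h1.trans ?_
  obtain ⟨Q, hQP, hQ, hQy⟩ := Ideal.exists_ideal_over_prime_of_isIntegral
    (⊥ : Ideal (MvPolynomial (Fin s) k)) (⊥ : Ideal A)
    (by
      rw [← RingHom.ker_eq_comap_bot]
      exact ((RingHom.injective_iff_ker_eq_bot (algebraMap (MvPolynomial (Fin s) k) A)).mp hg).le)
  have h2 := trdeg_le_of_injective ((Ideal.Quotient.mkₐ k Q).comp g) (by
    rw [← AlgHom.coe_toRingHom, RingHom.injective_iff_ker_eq_bot, eq_bot_iff, ← hQy]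
    intro x hx
    rw [RingHom.mem_ker] at hx
    exact (Ideal.Quotient.eq_zero_iff_mem (I := Q)).mp hx)
  have h3 := h2.trans (h Q hQ)
  rw [MvPolynomial.trdeg_of_isDomain] at h3
  simp at h3
  simpa using h3

theorem aux_le_dim {k B : Type} [Field k] [CommRing B] [IsDomain B] [Algebra k B]
    [Algebra.FiniteType k B]
    (m : ℕ) (h : m ≤ Algebra.trdeg k B) : m ≤ ringKrullDim B := by
  obtain ⟨s, g, hg, hgi⟩ := exists_integral_inj_algHom_of_fg k B
  let : Algebra (MvPolynomial (Fin s) k) B := g.toRingHom.toAlgebra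
  have : Algebra.IsIntegral (MvPolynomial (Fin s) k) B := ⟨hgi⟩
  have : IsScalarTower k (MvPolynomial (Fin s) k) B :=
    IsScalarTower.of_algebraMap_eq fun x => (g.commutes x).symm
  have : FaithfulSMul (MvPolynomial (Fin s) k) B := 
    (faithfulSMul_iff_algebraMap_injective _ _).mpr hg
  have h1 : ringKrullDim (MvPolynomial (Fin s) k) ≤ ringKrullDim B := aux_le_dim_of_integral hg
  rw [MvPolynomial.ringKrullDim_of_isNoetherianRing, ringKrullDim_eq_zero_of_field] at h1
  refine le_trans ?_ h1
  rw [← _root_.trdeg_add_eq k (MvPolynomial (Fin s) k) (A := B), _root_.trdeg_eq_zero (R := MvPolynomial (Fin s) k), 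
    MvPolynomial.trdeg_of_isDomain] at h
  simp at h
  simpa using h

theorem aux_shift (n : ℕ) (hn : 1 ≤ n) (k : ℕ) (hk : k < n) (i : Fin n) :
    ((Matrix.of fun i j : Fin n => if (i : ℕ) = j + 1 then (1 : ℂ) else 0) ^ k) i ⟨0, hn⟩ =
      if (i : ℕ) = k then 1 else 0 := by
  induction k generalizing i with
  | zero => simp [Matrix.one_apply, Fin.ext_iff]
  | succ k ih =>
    rw [pow_succ', Matrix.mul_apply]
    have : ∀ j : Fin n, ((Matrix.of fun i j : Fin n => if (i : ℕ) = j + 1 then (1 : ℂ) else 0) ^ k)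
        j ⟨0, hn⟩ = if j = ⟨k, by omega⟩ then 1 else 0 := by
      intro j
      rw [ih (by omega)]
      simp [Fin.ext_iff]
    simp only [this]
    simp

noncomputable def auxGX (n : ℕ) : Matrix (Fin n) (Fin n) (MvPolynomial ((Fin n × Fin n) ⊕ Fin n) ℂ) :=
  Matrix.of fun i j => MvPolynomial.X (Sum.inl (i, j))

noncomputable def auxGY (n : ℕ) : Matrix (Fin n) (Fin n) (MvPolynomial ((Fin n × Fin n) ⊕ Fin n) ℂ) :=
  ∑ k : Fin n, (MvPolynomial.X (Sum.inr k) : MvPolynomial ((Fin n × Fin n) ⊕ Fin n) ℂ) •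
    auxGX n ^ (k : ℕ)

noncomputable def auxphi (n : ℕ) : MvPolynomial ((Fin n × Fin n) ⊕ (Fin n × Fin n)) ℂ →ₐ[ℂ]
    MvPolynomial ((Fin n × Fin n) ⊕ Fin n) ℂ :=
  MvPolynomial.aeval (Sum.elim (fun p => auxGX n p.1 p.2) (fun p => auxGY n p.1 p.2))

theorem auxphi_genX (n : ℕ) : (genX n).map (auxphi n) = auxGX n := by
  ext1 i j; simp [genX, auxphi]

theorem auxphi_genY (n : ℕ) : (genY n).map (auxphi n) = auxGY n := by
  ext1 i j; simp [genY, auxphi]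

theorem aux_comm (n : ℕ) : auxGX n * auxGY n = auxGY n * auxGX n := by
  unfold auxGY
  rw [Finset.mul_sum, Finset.sum_mul]
  refine Finset.sum_congr rfl fun k _ => ?_
  rw [mul_smul_comm, smul_mul_assoc, pow_mul_comm']

theorem auxphi_ker (n : ℕ) (p : Fin n × Fin n) :
    auxphi n ((genX n * genY n - genY n * genX n) p.1 p.2) = 0 := by
  have h : (genX n * genY n - genY n * genX n).map (auxphi n) = 0 := by
    change (auxphi n).mapMatrix (genX n * genY n - genY n * genX n) = 0
    have hX : (auxphi n).mapMatrix (genX n) = auxGX n := auxphi_genX n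
    have hY : (auxphi n).mapMatrix (genY n) = auxGY n := auxphi_genY n
    rw [map_sub, map_mul, map_mul, hX, hY, aux_comm, sub_self]
  exact congrFun (congrFun h p.1) p.2

noncomputable def auxM (n : ℕ) (hn : 1 ≤ n) :
    Matrix (Fin n) (Fin n) (MvPolynomial ((Fin n × Fin n) ⊕ Fin n) ℂ) :=
  Matrix.of fun i k => (auxGX n ^ (k : ℕ)) i ⟨0, hn⟩

theorem auxM_det (n : ℕ) (hn : 1 ≤ n) : (auxM n hn).det ≠ 0 := by
  let N : Matrix (Fin n) (Fin n) ℂ := Matrix.of fun i j : Fin n => if (i : ℕ) = j + 1 then (1 : ℂ) else 0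
  let ev : MvPolynomial ((Fin n × Fin n) ⊕ Fin n) ℂ →+* ℂ :=
    MvPolynomial.eval (Sum.elim (fun p => N p.1 p.2) (fun _ => 0))
  have hX : ev.mapMatrix (auxGX n) = N := by
    ext i j
    simp [ev, auxGX]
  have h1 : ev.mapMatrix (auxM n hn) = 1 := by
    ext i k
    have h2 : ev.mapMatrix (auxM n hn) i k = (ev.mapMatrix (auxGX n ^ (k : ℕ))) i ⟨0, hn⟩ := rfl
    rw [h2, map_pow, hX, aux_shift n hn k k.2 i, Matrix.one_apply]
    simp [Fin.ext_iff]
  intro h0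
  have h3 : ev (auxM n hn).det = 1 := by
    rw [RingHom.map_det, h1, Matrix.det_one]
  rw [h0, map_zero] at h3
  exact zero_ne_one h3

theorem auxM_mulVec (n : ℕ) (hn : 1 ≤ n) :
    (auxM n hn).mulVec (fun k => MvPolynomial.X (Sum.inr k)) = fun i => auxGY n i ⟨0, hn⟩ := by
  ext1 i
  simp only [Matrix.mulVec, dotProduct, auxM, auxGY, Matrix.of_apply, Matrix.sum_apply,
    Matrix.smul_apply, smul_eq_mul]
  exact Finset.sum_congr rfl fun k _ => mul_comm _ _

theorem aux_algebraic (n : ℕ) (hn : 1 ≤ n) :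
    Algebra.IsAlgebraic (auxphi n).range (MvPolynomial ((Fin n × Fin n) ⊕ Fin n) ℂ) := by
  let B := (auxphi n).range
  have hXB : ∀ i j, auxGX n i j ∈ B := fun i j =>
    ⟨genX n i j, congrFun (congrFun (auxphi_genX n) i) j⟩
  have hYB : ∀ i j, auxGY n i j ∈ B := fun i j =>
    ⟨genY n i j, congrFun (congrFun (auxphi_genY n) i) j⟩
  have halg : ∀ x ∈ B, IsAlgebraic B x := fun x hx =>
    isAlgebraic_algebraMap (⟨x, hx⟩ : B)
  let X' : Matrix (Fin n) (Fin n) B := Matrix.of fun i j => ⟨auxGX n i j, hXB i j⟩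
  let v : B →+* MvPolynomial ((Fin n × Fin n) ⊕ Fin n) ℂ := B.val.toRingHom
  have hX' : v.mapMatrix X' = auxGX n := rfl
  let M' : Matrix (Fin n) (Fin n) B := Matrix.of fun i k => (X' ^ (k : ℕ)) i ⟨0, hn⟩
  have hM' : v.mapMatrix M' = auxM n hn := by
    ext1 i k
    change (v.mapMatrix (X' ^ (k : ℕ))) i ⟨0, hn⟩ = _
    rw [map_pow, hX']; rfl
  have hdet : (auxM n hn).det ∈ B := by
    rw [← hM', ← RingHom.map_det]
    exact (M'.det).2
  have hadj : ∀ i j, (auxM n hn).adjugate i j ∈ B := by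
    intro i j
    rw [← hM', ← RingHom.map_adjugate]
    exact (M'.adjugate i j).2
  have hc : ∀ k : Fin n, IsAlgebraic B
      (MvPolynomial.X (Sum.inr k) : MvPolynomial ((Fin n × Fin n) ⊕ Fin n) ℂ) := by
    intro k
    refine IsAlgebraic.of_mul (mem_nonZeroDivisors_of_ne_zero (auxM_det n hn))
      (halg _ hdet) (halg _ ?_)
    have h := congrArg ((auxM n hn).adjugate.mulVec) (auxM_mulVec n hn)
    rw [Matrix.mulVec_mulVec, Matrix.adjugate_mul, Matrix.smul_mulVec, Matrix.one_mulVec] at h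
    have hk := congrFun h k
    simp only [Pi.smul_apply, smul_eq_mul] at hk
    rw [hk]
    rw [Matrix.mulVec, dotProduct]
    exact Subalgebra.sum_mem _ fun j _ => Subalgebra.mul_mem _ (hadj _ _) (hYB _ _)
  refine ⟨fun x => ?_⟩
  induction x using MvPolynomial.induction_on with
  | C a => exact halg _ (B.algebraMap_mem a)
  | add p q hp hq => exact hp.add hq
  | mul_X p i hp =>
    refine hp.mul ?_
    rcases i with ⟨i, j⟩ | k
    · exact halg _ (hXB i j)
    · exact hc k

theorem aux_lower (n : ℕ) (hn : 1 ≤ n) :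
    ((n ^ 2 + n : ℕ) : WithBot ℕ∞) ≤ ringKrullDim
      (MvPolynomial ((Fin n × Fin n) ⊕ (Fin n × Fin n)) ℂ ⧸
        Ideal.span (Set.range fun p : Fin n × Fin n =>
          (genX n * genY n - genY n * genX n) p.1 p.2)) := by
  have h1 : ((n ^ 2 + n : ℕ) : WithBot ℕ∞) ≤ ringKrullDim (auxphi n).range := by
    have hfin : Algebra.FiniteType ℂ (auxphi n).range :=
      Algebra.FiniteType.of_surjective (auxphi n).rangeRestrict (auxphi n).rangeRestrict_surjective
    refine aux_le_dim (k := ℂ) _ ?_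
    have := aux_algebraic n hn
    have h := _root_.trdeg_add_eq ℂ (auxphi n).range
      (A := MvPolynomial ((Fin n × Fin n) ⊕ Fin n) ℂ)
    rw [_root_.trdeg_eq_zero (R := (auxphi n).range), MvPolynomial.trdeg_of_isDomain, add_zero] at h
    rw [h]
    simp [sq]
  refine h1.trans (ringKrullDim_le_of_surjective
    (Ideal.Quotient.lift _ (auxphi n).rangeRestrict.toRingHom ?_)
    (Ideal.Quotient.lift_surjective_of_surjective _ _ (auxphi n).rangeRestrict_surjective))
  intro a ha
  have : Ideal.span (Set.range fun p : Fin n × Fin n =>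
          (genX n * genY n - genY n * genX n) p.1 p.2) ≤ RingHom.ker (auxphi n) := by
    rw [Ideal.span_le]
    rintro _ ⟨p, rfl⟩
    exact auxphi_ker n p
  exact Subtype.ext (this ha)


theorem aux_comp0 {K : Type*} [Field K] [Algebra ℂ K] (l : K) (e : ℕ) :
    ∃ b : Module.Basis (Fin e) K (AdjoinRoot ((Polynomial.X - Polynomial.C l) ^ e)),
      ∀ j k, b.repr (AdjoinRoot.root _ * b j) k ∈ IntermediateField.adjoin ℂ {l} := by
  have hm : ((Polynomial.X - Polynomial.C l) ^ e).Monic := (Polynomial.monic_X_sub_C l).pow e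
  have hd : ((Polynomial.X - Polynomial.C l) ^ e).natDegree = e := by
    rw [Polynomial.natDegree_pow, Polynomial.natDegree_X_sub_C, mul_one]
  let F := IntermediateField.adjoin ℂ {l}
  have hl : l ∈ F := IntermediateField.mem_adjoin_simple_self ℂ l
  have hcoef : ∀ i, ((Polynomial.X - Polynomial.C l) ^ e).coeff i ∈ F := by
    intro i
    have : ((Polynomial.X - Polynomial.C l) ^ e) =
        ((Polynomial.X - Polynomial.C (⟨l, hl⟩ : F)) ^ e).map (algebraMap F K) := by
      rw [Polynomial.map_pow, Polynomial.map_sub, Polynomial.map_X, Polynomial.map_C]; rfl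
    rw [this, Polynomial.coeff_map]
    exact (((Polynomial.X - Polynomial.C (⟨l, hl⟩ : F)) ^ e).coeff i).2
  let pb := AdjoinRoot.powerBasis' hm
  have hdim : pb.dim = e := hd
  have hgen : pb.minpolyGen = (Polynomial.X - Polynomial.C l) ^ e := by
    rw [PowerBasis.minpolyGen_eq]
    change minpoly K (AdjoinRoot.root _) = _
    rw [AdjoinRoot.minpoly_root hm.ne_zero, hm.leadingCoeff]
    simp
  refine ⟨pb.basis.reindex (finCongr hdim), fun j k => ?_⟩
  have h := PowerBasis.leftMulMatrix pb
  have h2 := congrFun (congrFun h ((finCongr hdim).symm k)) ((finCongr hdim).symm j)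
  rw [Algebra.leftMulMatrix_eq_repr_mul] at h2
  rw [Module.Basis.reindex_apply, Module.Basis.repr_reindex_apply]
  refine (congrArg (· ∈ F) h2).mpr ?_
  simp only [Matrix.of_apply]
  split_ifs
  · rw [hgen]; exact F.neg_mem (hcoef _)
  · exact F.one_mem
  · exact F.zero_mem

open Polynomial in
theorem aux_comp {K : Type*} [Field K] [Algebra ℂ K] (l : K) (e : ℕ) :
    ∃ b : Module.Basis (Fin e) K (K[X] ⧸ (Submodule.span K[X] {(Polynomial.X - Polynomial.C l) ^ e})),
      ∀ j k, b.repr ((Polynomial.X : K[X]) • b j) k ∈ IntermediateField.adjoin ℂ {l} := by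
  obtain ⟨b, hb⟩ := aux_comp0 l e
  let E : AdjoinRoot ((Polynomial.X - Polynomial.C l) ^ e) ≃ₗ[K]
    (K[X] ⧸ (Submodule.span K[X] {(Polynomial.X - Polynomial.C l) ^ e})) :=
    LinearEquiv.refl K _
  refine ⟨b.map E, fun j k => ?_⟩
  have : E.symm ((Polynomial.X : K[X]) • E (b j)) = AdjoinRoot.root _ * b j := by
    obtain ⟨q, hq⟩ := AdjoinRoot.mk_surjective (b j)
    rw [← hq, ← AdjoinRoot.mk_X, ← map_mul]
    rfl
  rw [Module.Basis.map_apply, Module.Basis.map_repr, LinearEquiv.trans_apply, this]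
  exact hb j k

open Polynomial in
theorem aux_comp' {K : Type*} [Field K] [IsAlgClosed K] [Algebra ℂ K] (p : K[X])
    (hp : Irreducible p) (e : ℕ) :
    ∃ (l : K) (b : Module.Basis (Fin e) K (K[X] ⧸ (Submodule.span K[X] {p ^ e}))),
      ∀ j k, b.repr ((Polynomial.X : K[X]) • b j) k ∈ IntermediateField.adjoin ℂ {l} := by
  have hdeg := IsAlgClosed.degree_eq_one_of_irreducible K hp
  obtain ⟨l, hl⟩ := IsAlgClosed.exists_root p (by rw [hdeg]; exact one_ne_zero)
  refine ⟨l, ?_⟩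
  have hass : Associated p (Polynomial.X - Polynomial.C l) := by
    refine (Irreducible.associated_of_dvd (Polynomial.irreducible_X_sub_C l) hp ?_).symm
    exact Polynomial.dvd_iff_isRoot.mpr hl
  have h : Submodule.span K[X] {p ^ e} = Submodule.span K[X] {(Polynomial.X - Polynomial.C l) ^ e} :=
    Ideal.span_singleton_eq_span_singleton.mpr (hass.pow_pow)
  rw [h]
  exact aux_comp l e

/-- coordinates -/
theorem aux_coord {K ι : Type*} [Field K] [Fintype ι] [DecidableEq ι] (V : Submodule K (ι → K)) :
    ∃ I : Finset ι, I.card = Module.finrank K V ∧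
      (∀ k, ∃ c : ι → K, ∀ v ∈ V, v k = ∑ i ∈ I, c i * v i) ∧
      ∀ u : ι → K, ∃ v ∈ V, ∀ i ∈ I, v i = u i := by
  let φ : ι → Module.Dual K V := fun k => (LinearMap.proj k).comp V.subtype
  obtain ⟨κ, a, ha, hspan, hli⟩ := exists_linearIndependent' K φ
  have : Finite κ := Finite.of_injective a ha
  have := Fintype.ofFinite κ
  have hc : ∀ k, ∃ c : κ → K, ∀ v ∈ V, v k = ∑ i, c i * v (a i) := by
    intro k
    have hk : φ k ∈ Submodule.span K (Set.range (φ ∘ a)) := by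
      rw [hspan]; exact Submodule.subset_span ⟨k, rfl⟩
    rw [Submodule.mem_span_range_iff_exists_fun] at hk
    obtain ⟨c, hc⟩ := hk
    refine ⟨c, fun v hv => ?_⟩
    have := congrArg (fun f : Module.Dual K V => f ⟨v, hv⟩) hc
    simp only [LinearMap.sum_apply, LinearMap.smul_apply, smul_eq_mul] at this
    exact this.symm
  let ρ : V →ₗ[K] (κ → K) := LinearMap.pi (fun i => φ (a i))
  have hρ : Function.Injective ρ := by
    rw [injective_iff_map_eq_zero]
    intro v hv
    ext k
    obtain ⟨c, hc⟩ := hc k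
    rw [hc v v.2]
    refine Finset.sum_eq_zero fun i _ => ?_
    have : v.1 (a i) = 0 := congrFun hv i
    rw [this, mul_zero]
  have h1 : Module.finrank K V ≤ Fintype.card κ := by
    have := LinearMap.finrank_le_finrank_of_injective hρ
    simpa using this
  have h2 : Fintype.card κ ≤ Module.finrank K V := by
    have := hli.fintype_card_le_finrank
    rwa [Subspace.dual_finrank_eq] at this
  have hsurj : Function.Surjective ρ :=
    (LinearMap.injective_iff_surjective_of_finrank_eq_finrank (by simp; omega)).mp hρ
  refine ⟨Finset.univ.map ⟨a, ha⟩, ?_, ?_, ?_⟩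
  · simp; omega
  · intro k
    obtain ⟨c, hc⟩ := hc k
    refine ⟨Function.extend a c 0, fun v hv => ?_⟩
    rw [hc v hv, Finset.sum_map]
    refine Finset.sum_congr rfl fun j _ => ?_
    simp [ha.extend_apply]
  · intro u
    obtain ⟨v, hv⟩ := hsurj (fun i => u (a i))
    refine ⟨v, v.2, ?_⟩
    intro i hi
    simp only [Finset.mem_map, Finset.mem_univ, true_and] at hi
    obtain ⟨j, rfl⟩ := hi
    exact congrFun hv j

theorem aux_generic {K : Type*} [Field K] [Algebra ℂ K] (n : ℕ)
    (V : Submodule K (Fin n × Fin n → K)) (g0 : Fin n × Fin n → K) (hg0 : g0 ∈ V)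
    (hdet0 : (Matrix.of fun i j => g0 (i, j)).det ≠ 0) :
    ∃ I : Finset (Fin n × Fin n), I.card = Module.finrank K V ∧ ∃ g ∈ V,
      (Matrix.of fun i j => g (i, j)).det ≠ 0 ∧ ∀ i ∈ I, g i ∈ Set.range (algebraMap ℂ K) := by
  obtain ⟨I, hI, hc, hfree⟩ := aux_coord V
  refine ⟨I, hI, ?_⟩
  choose c hc using hc
  let M : Matrix (Fin n) (Fin n) (MvPolynomial (Fin n × Fin n) K) :=
    Matrix.of fun i j => ∑ k ∈ I, MvPolynomial.C (c (i, j) k) * MvPolynomial.X k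
  have hM : ∀ (u : Fin n × Fin n → K), ∀ v ∈ V, (∀ i ∈ I, v i = u i) →
      MvPolynomial.eval u M.det = (Matrix.of fun i j => v (i, j)).det := by
    intro u v hv huv
    rw [RingHom.map_det]
    congr 1
    ext i j
    simp only [M, RingHom.mapMatrix_apply, Matrix.map_apply, Matrix.of_apply, map_sum, map_mul,
      MvPolynomial.eval_C, MvPolynomial.eval_X]
    rw [hc (i, j) v hv]
    exact Finset.sum_congr rfl fun k hk => by rw [huv k hk]
  have hne : M.det ≠ 0 := by
    intro h
    have := hM g0 g0 hg0 (fun _ _ => rfl)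
    rw [h, map_zero] at this
    exact hdet0 this.symm
  have : ∃ u ∈ Set.pi Set.univ (fun _ : Fin n × Fin n => Set.range (algebraMap ℂ K)),
      MvPolynomial.eval u M.det ≠ 0 := by
    by_contra! hcon
    refine hne (MvPolynomial.funext_set (fun _ => Set.range (algebraMap ℂ K))
      (fun _ => Set.infinite_range_of_injective (algebraMap ℂ K).injective) fun u hu => ?_)
    rw [hcon u hu, map_zero]
  obtain ⟨u, hu, hune⟩ := this
  obtain ⟨g, hg, hgu⟩ := hfree u
  refine ⟨g, hg, ?_, ?_⟩
  · rw [← hM u g hg hgu]; exact hune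
  · intro i hi
    rw [hgu i hi]
    exact hu i trivial


open Polynomial in
theorem aux_conj {K : Type} [Field K] [IsAlgClosed K] [Algebra ℂ K] (n : ℕ)
    (X : Matrix (Fin n) (Fin n) K) :
    ∃ (T : Finset K) (J g : Matrix (Fin n) (Fin n) K), T.card ≤ n ∧
      (∀ i j, J i j ∈ IntermediateField.adjoin ℂ (T : Set K)) ∧ IsUnit g.det ∧ X * g = g * J := by
  classical
  let φ : Module.End K (Fin n → K) := Matrix.toLin' X
  obtain ⟨ι, hι, p, hp, e, ⟨E⟩⟩ := Module.equiv_directSum_of_isTorsion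
    (Module.AEval.isTorsion_of_finiteDimensional K (Fin n → K) φ)
  choose l b hb using fun i => aux_comp' (p i) (hp i) (e i)
  let D := DirectSum ι fun i => K[X] ⧸ (Submodule.span K[X] {p i ^ e i})
  let BD : Module.Basis (Σ i, Fin (e i)) K D := DFinsupp.basis b
  let E' : Module.AEval K (Fin n → K) φ ≃ₗ[K] D := E.restrictScalars K
  let E0 : (Fin n → K) ≃ₗ[K] D := (Module.AEval.of K (Fin n → K) φ).trans E'
  let B0 : Module.Basis (Σ i, Fin (e i)) K (Fin n → K) := BD.map E0.symm
  have hcard : Fintype.card (Σ i, Fin (e i)) = n := by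
    have := Module.finrank_eq_card_basis B0
    simpa using this.symm
  let T : Finset K := (Finset.univ : Finset (Σ i, Fin (e i))).image fun x => l x.1
  have hT : T.card ≤ n := Finset.card_image_le.trans (by rw [Finset.card_univ, hcard])
  have hE0 : ∀ v, E0 (φ v) = (Polynomial.X : K[X]) • E0 v := by
    intro v
    change E (Module.AEval.of K (Fin n → K) φ (φ v)) = _
    have : Module.AEval.of K (Fin n → K) φ (φ v) =
      (Polynomial.X : K[X]) • Module.AEval.of K (Fin n → K) φ v := by
      rw [Module.AEval.X_smul_of]; rfl
    rw [this, map_smul]; rfl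
  have hrepr : ∀ x y, B0.repr (φ (B0 x)) y ∈ IntermediateField.adjoin ℂ (T : Set K) := by
    rintro ⟨i, j⟩ ⟨i', j'⟩
    have h1 : B0.repr (φ (B0 ⟨i, j⟩)) ⟨i', j'⟩ = BD.repr ((Polynomial.X : K[X]) • BD ⟨i, j⟩) ⟨i', j'⟩ := by
      simp only [B0, Module.Basis.map_repr, LinearEquiv.trans_apply, LinearEquiv.symm_symm,
        Module.Basis.map_apply, hE0, LinearEquiv.apply_symm_apply]
    have h2 : BD ⟨i, j⟩ = DirectSum.lof K ι (fun i => K[X] ⧸ (Submodule.span K[X] {p i ^ e i})) i (b i j) := by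
      apply BD.repr.injective
      rw [Module.Basis.repr_self]
      ext ⟨a, c⟩
      have h5 : BD.repr (DirectSum.lof K ι
          (fun i => K[X] ⧸ (Submodule.span K[X] {p i ^ e i})) i (b i j)) ⟨a, c⟩ =
          (b a).repr ((DirectSum.lof K ι
          (fun i => K[X] ⧸ (Submodule.span K[X] {p i ^ e i})) i (b i j)) a) c := rfl
      rw [h5]
      by_cases hi : i = a
      · subst hi
        rw [DirectSum.lof_apply, Module.Basis.repr_self, Finsupp.single_apply, Finsupp.single_apply]
        simp
      · have : (DirectSum.lof K ι (fun i => K[X] ⧸ (Submodule.span K[X] {p i ^ e i})) i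
            (b i j)) a = 0 := DFinsupp.single_eq_of_ne (Ne.symm hi)
        rw [this, map_zero, Finsupp.single_apply, if_neg]
        · rfl
        · intro h
          exact hi (congrArg Sigma.fst h)
    have h3 : (Polynomial.X : K[X]) • BD ⟨i, j⟩ = DirectSum.lof K[X] ι (fun i => K[X] ⧸ (Submodule.span K[X] {p i ^ e i})) i ((Polynomial.X : K[X]) • b i j) := by
      rw [map_smul, h2]; rfl
    have h4 : BD.repr ((Polynomial.X : K[X]) • BD ⟨i, j⟩) ⟨i', j'⟩ =
      (b i').repr ((DirectSum.lof K[X] ι (fun i => K[X] ⧸ (Submodule.span K[X] {p i ^ e i})) i ((Polynomial.X : K[X]) • b i j)) i') j' := by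
      rw [h3]; rfl
    rw [h1, h4]
    by_cases hi : i = i'
    · subst hi
      rw [DirectSum.lof_apply]
      refine IntermediateField.adjoin.mono ℂ _ _ ?_ (hb i j j')
      intro x hx
      rw [Set.mem_singleton_iff] at hx
      subst hx
      exact Finset.mem_coe.mpr (Finset.mem_image.mpr ⟨⟨i, j⟩, Finset.mem_univ _, rfl⟩)
    · have : (DirectSum.lof K[X] ι (fun i => K[X] ⧸ (Submodule.span K[X] {p i ^ e i})) i ((Polynomial.X : K[X]) • b i j)) i' = 0 :=
        DFinsupp.single_eq_of_ne (Ne.symm hi)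
      rw [this, map_zero]
      exact IntermediateField.zero_mem _
  let B : Module.Basis (Fin n) K (Fin n → K) := B0.reindex (Fintype.equivFinOfCardEq hcard)
  refine ⟨T, LinearMap.toMatrix B B φ, (Pi.basisFun K (Fin n)).toMatrix B, hT, ?_, ?_, ?_⟩
  · intro i j
    rw [LinearMap.toMatrix_apply, Module.Basis.reindex_apply, Module.Basis.repr_reindex_apply]
    exact hrepr _ _
  · have h := (Pi.basisFun K (Fin n)).toMatrix_mul_toMatrix_flip B
    exact Matrix.isUnit_det_of_right_inverse h
  · have h1 := basis_toMatrix_mul_linearMap_toMatrix B (Pi.basisFun K (Fin n)) B φ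
    have h2 := linearMap_toMatrix_mul_basis_toMatrix B (Pi.basisFun K (Fin n)) (Pi.basisFun K (Fin n)) φ
    rw [h1, ← h2]
    congr 1
    rw [LinearMap.toMatrix_eq_toMatrix', LinearMap.toMatrix'_toLin']


def auxMat {K : Type*} {n : ℕ} (v : Fin n × Fin n → K) : Matrix (Fin n) (Fin n) K :=
  Matrix.of fun i j => v (i, j)

/-- The space of intertwiners `A M = M B`. -/
def auxV {K : Type*} [Field K] {n : ℕ} (A B : Matrix (Fin n) (Fin n) K) :
    Submodule K (Fin n × Fin n → K) where
  carrier := {v | A * auxMat v = auxMat v * B}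
  zero_mem' := by
    change A * (0 : Matrix (Fin n) (Fin n) K) = (0 : Matrix (Fin n) (Fin n) K) * B
    simp
  add_mem' := by
    intro v w hv hw
    change A * (auxMat v + auxMat w) = (auxMat v + auxMat w) * B
    rw [mul_add, add_mul, hv, hw]
  smul_mem' := by
    intro c v hv
    change A * (c • auxMat v) = (c • auxMat v) * B
    rw [mul_smul_comm, smul_mul_assoc, hv]

theorem aux_mem_inv {K : Type*} [Field K] [Algebra ℂ K] {n : ℕ} (E : IntermediateField ℂ K)
    (g : Matrix (Fin n) (Fin n) K) (hg : ∀ i j, g i j ∈ E) (i j : Fin n) : g⁻¹ i j ∈ E := by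
  let g' : Matrix (Fin n) (Fin n) E := Matrix.of fun i j => ⟨g i j, hg i j⟩
  have hg' : (algebraMap E K).mapMatrix g' = g := rfl
  rw [Matrix.inv_def, Ring.inverse_eq_inv', Matrix.smul_apply, smul_eq_mul]
  refine E.mul_mem (E.inv_mem ?_) ?_
  · rw [← hg', ← RingHom.map_det]; exact (g'.det).2
  · rw [← hg', ← RingHom.map_adjugate]; exact (g'.adjugate i j).2

theorem aux_mem_mul {K : Type*} [Field K] [Algebra ℂ K] {n : ℕ} (E : IntermediateField ℂ K)
    (g h : Matrix (Fin n) (Fin n) K) (hg : ∀ i j, g i j ∈ E) (hh : ∀ i j, h i j ∈ E)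
    (i j : Fin n) : (g * h) i j ∈ E := by
  rw [Matrix.mul_apply]
  exact sum_mem fun k _ => E.mul_mem (hg _ _) (hh _ _)

theorem aux_descent {F K : Type*} [Field F] [Field K] [Algebra F K] {n : ℕ}
    (J : Matrix (Fin n) (Fin n) F) (I : Finset (Fin n × Fin n)) (k : Fin n × Fin n)
    (c : Fin n × Fin n → F) (hc : ∀ v ∈ auxV J J, v k = ∑ i ∈ I, c i * v i)
    (w : Fin n × Fin n → K) (hw : w ∈ auxV (J.map (algebraMap F K)) (J.map (algebraMap F K))) :
    w k = ∑ i ∈ I, algebraMap F K (c i) * w i := by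
  rw [← sub_eq_zero, ← Module.forall_dual_apply_eq_zero_iff F]
  intro h
  have hv : (fun i => h (w i)) ∈ auxV J J := by
    change J * auxMat (fun i => h (w i)) = auxMat (fun i => h (w i)) * J
    ext i j
    have h1 : (J.map (algebraMap F K) * auxMat w) i j = (auxMat w * J.map (algebraMap F K)) i j :=
      congrFun (congrFun hw i) j
    have h2 := congrArg h h1
    simp only [Matrix.mul_apply, map_sum, Matrix.map_apply, auxMat, Matrix.of_apply] at h2 ⊢
    have h3 : ∀ (a : F) (b : K), h (algebraMap F K a * b) = a * h b := fun a b => by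
      rw [← Algebra.smul_def, map_smul, smul_eq_mul]
    have h4 : ∀ (a : F) (b : K), h (b * algebraMap F K a) = h b * a := fun a b => by
      rw [mul_comm, h3, mul_comm]
    simpa only [h3, h4] using h2
  have h5 := hc _ hv
  rw [map_sub, map_sum, h5, sub_eq_zero]
  refine Finset.sum_congr rfl fun i _ => ?_
  rw [← Algebra.smul_def, map_smul, smul_eq_mul]

theorem aux_upper {K : Type} [Field K] [IsAlgClosed K] [Algebra ℂ K] (n : ℕ)
    (X Y : Matrix (Fin n) (Fin n) K) (hXY : X * Y = Y * X) :
    ∃ T : Finset K, T.card ≤ n ^ 2 + n ∧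
      (∀ i j, X i j ∈ IntermediateField.adjoin ℂ (T : Set K)) ∧
      (∀ i j, Y i j ∈ IntermediateField.adjoin ℂ (T : Set K)) := by
  classical
  obtain ⟨T0, J, g0, hT0, hJ, hg0, hXg0⟩ := aux_conj n X
  let F := IntermediateField.adjoin ℂ (T0 : Set K)
  let JF : Matrix (Fin n) (Fin n) F := Matrix.of fun i j => ⟨J i j, hJ i j⟩
  have hJF : JF.map (algebraMap F K) = J := rfl
  obtain ⟨I, hI, hc, hfree⟩ := aux_coord (auxV JF JF)
  -- lower bound for the space of intertwiners
  have hdim : I.card ≤ Module.finrank K (auxV X J) := by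
    choose w hwV hw using fun i : I => hfree (fun k => if k = i then 1 else 0)
    let W : I → Matrix (Fin n) (Fin n) K := fun i => (auxMat (w i)).map (algebraMap F K)
    have hW : ∀ i, J * W i = W i * J := by
      intro i
      have h1 : JF * auxMat (w i) = auxMat (w i) * JF := hwV i
      have h2 := congrArg (algebraMap F K).mapMatrix h1
      rw [map_mul, map_mul] at h2
      exact h2
    let z : I → auxV X J := fun i => ⟨fun p => (g0 * W i) p.1 p.2, by
      change X * (g0 * W i) = (g0 * W i) * J
      rw [← mul_assoc, hXg0, mul_assoc, hW, mul_assoc]⟩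
    have hli : LinearIndependent K z := by
      rw [Fintype.linearIndependent_iff]
      intro u hu i
      have h1 : ∑ k, u k • (g0 * W k) = 0 := by
        ext a b
        have h3 := congrFun (congrArg (Subtype.val) hu) (a, b)
        simpa [Matrix.sum_apply, z] using h3
      have h2 : g0 * ∑ k, u k • W k = 0 := by
        rw [Finset.mul_sum, ← h1]
        exact Finset.sum_congr rfl fun k _ => by rw [mul_smul_comm]
      have h3 : ∑ k, u k • W k = 0 := by
        have := congrArg (g0⁻¹ * ·) h2
        simpa [← mul_assoc, Matrix.nonsing_inv_mul g0 hg0] using this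
      have h4 := congrFun (congrFun h3 i.1.1) i.1.2
      simp only [Matrix.sum_apply, Matrix.smul_apply, smul_eq_mul, Matrix.zero_apply] at h4
      have h5 : ∀ k : I, W k i.1.1 i.1.2 = if i = k then 1 else 0 := by
        intro k
        change algebraMap F K (w k i.1) = _
        rw [hw k i.1 i.2]
        by_cases h : i = k
        · simp [h]
        · have : i.1 ≠ k.1 := fun h' => h (Subtype.ext h')
          simp [h, this]
      simpa [h5] using h4
    have := hli.fintype_card_le_finrank
    simpa using this
  obtain ⟨I', hI', g, hgV, hgdet, hgI⟩ := aux_generic n (auxV X J) (fun p => g0 p.1 p.2) hXg0 hg0.ne_zero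
  let G : Matrix (Fin n) (Fin n) K := auxMat g
  have hG : IsUnit G.det := isUnit_iff_ne_zero.mpr hgdet
  have hXG : X * G = G * J := hgV
  let Z : Matrix (Fin n) (Fin n) K := G⁻¹ * Y * G
  have hGi : G * G⁻¹ = 1 := Matrix.mul_nonsing_inv G hG
  have hiG : G⁻¹ * G = 1 := Matrix.nonsing_inv_mul G hG
  have hX : X = G * J * G⁻¹ := by rw [← hXG, mul_assoc, hGi, mul_one]
  have hY : Y = G * Z * G⁻¹ := by
    simp only [Z]
    rw [mul_assoc, mul_assoc (G⁻¹ * Y), hGi, mul_one, ← mul_assoc, hGi, one_mul]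
  have hJ' : J = G⁻¹ * X * G := by rw [mul_assoc, hXG, ← mul_assoc, hiG, one_mul]
  have hZJ : J * Z = Z * J := by
    have e1 : J * Z = G⁻¹ * (X * Y) * G := by
      rw [hJ']; simp only [Z]
      calc _ = G⁻¹ * X * (G * G⁻¹) * Y * G := by simp only [mul_assoc]
        _ = _ := by rw [hGi, mul_one]; simp only [mul_assoc]
    have e2 : Z * J = G⁻¹ * (Y * X) * G := by
      rw [hJ']; simp only [Z]
      calc _ = G⁻¹ * Y * (G * G⁻¹) * X * G := by simp only [mul_assoc]
        _ = _ := by rw [hGi, mul_one]; simp only [mul_assoc]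
    rw [e1, e2, hXY]
  let T1 : Finset K := I'ᶜ.image g
  let T2 : Finset K := I.image fun p => Z p.1 p.2
  let T : Finset K := T0 ∪ T1 ∪ T2
  have hT : T.card ≤ n ^ 2 + n := by
    have h1 : T1.card ≤ n ^ 2 - I'.card := by
      refine Finset.card_image_le.trans ?_
      rw [Finset.card_compl, Fintype.card_prod, Fintype.card_fin, sq]
    have h2 : T2.card ≤ I.card := Finset.card_image_le
    have h3 : I'.card ≤ n ^ 2 := by
      refine (Finset.card_le_univ _).trans ?_
      rw [Fintype.card_prod, Fintype.card_fin, sq]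
    have h4 : T.card ≤ T0.card + T1.card + T2.card :=
      (Finset.card_union_le _ _).trans (Nat.add_le_add_right (Finset.card_union_le _ _) _)
    omega
  let E := IntermediateField.adjoin ℂ (T : Set K)
  have hTE : ∀ x ∈ T, x ∈ E := fun x hx => IntermediateField.subset_adjoin ℂ _ hx
  have hFE : F ≤ E := IntermediateField.adjoin.mono ℂ _ _ (by
    intro x hx
    simp only [T, Finset.coe_union]
    exact Or.inl (Or.inl hx))
  have hJE : ∀ i j, J i j ∈ E := fun i j => hFE (hJ i j)
  have hGE : ∀ i j, G i j ∈ E := by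
    intro i j
    change g (i, j) ∈ E
    by_cases h : (i, j) ∈ I'
    · obtain ⟨a, ha⟩ := hgI _ h
      rw [← ha]; exact E.algebraMap_mem a
    · refine hTE _ ?_
      simp only [T, Finset.mem_union]
      exact Or.inl (Or.inr (Finset.mem_image_of_mem _ (Finset.mem_compl.mpr h)))
  have hZE : ∀ i j, Z i j ∈ E := by
    intro i j
    obtain ⟨c, hc⟩ := hc (i, j)
    have h := aux_descent (K := K) JF I (i, j) c hc (fun p => Z p.1 p.2) (by
      rw [hJF]; exact hZJ)
    have h' : Z i j = ∑ p ∈ I, algebraMap F K (c p) * Z p.1 p.2 := h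
    rw [h']
    refine sum_mem fun p hp => E.mul_mem (hFE (c p).2) (hTE _ ?_)
    simp only [T, Finset.mem_union]
    exact Or.inr (Finset.mem_image_of_mem _ hp)
  have hGiE := aux_mem_inv E G hGE
  refine ⟨T, hT, ?_, ?_⟩
  · rw [hX]
    exact aux_mem_mul E _ _ (aux_mem_mul E _ _ hGE hJE) hGiE
  · rw [hY]
    exact aux_mem_mul E _ _ (aux_mem_mul E _ _ hGE hZE) hGiE

open scoped IntermediateField.algebraAdjoinAdjoin in
theorem aux_trdeg_adjoin {K : Type} [Field K] [Algebra ℂ K] (T : Finset K) :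
    Algebra.trdeg ℂ (IntermediateField.adjoin ℂ (T : Set K)) ≤ T.card := by
  have h1 : Algebra.trdeg ℂ (Algebra.adjoin ℂ (T : Set K)) ≤ T.card := by
    let f : MvPolynomial T ℂ →ₐ[ℂ] K := MvPolynomial.aeval (fun x : T => (x : K))
    have hr : f.range = Algebra.adjoin ℂ (T : Set K) := by
      have := Algebra.adjoin_range_eq_range_aeval ℂ (fun x : T => (x : K))
      rw [← this]
      congr 1
      simp
    rw [← hr]
    refine (trdeg_le_of_surjective f.rangeRestrict f.rangeRestrict_surjective).trans ?_
    rw [MvPolynomial.trdeg_of_isDomain]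
    simp
  have hf : FaithfulSMul ℂ (Algebra.adjoin ℂ (T : Set K)) :=
    (faithfulSMul_iff_algebraMap_injective _ _).mpr (algebraMap ℂ _).injective
  have h := _root_.trdeg_add_eq ℂ (Algebra.adjoin ℂ (T : Set K))
    (A := IntermediateField.adjoin ℂ (T : Set K))
  rw [_root_.trdeg_eq_zero (R := Algebra.adjoin ℂ (T : Set K)), add_zero] at h
  rw [← h]
  exact h1

theorem aux_dim_upper (n : ℕ) :
    ringKrullDim
      (MvPolynomial ((Fin n × Fin n) ⊕ (Fin n × Fin n)) ℂ ⧸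
        Ideal.span (Set.range fun p : Fin n × Fin n =>
          (genX n * genY n - genY n * genX n) p.1 p.2)) ≤ ((n ^ 2 + n : ℕ) : WithBot ℕ∞) := by
  refine aux_dim_le (k := ℂ) (n ^ 2 + n) fun P hP => ?_
  let L := FractionRing ((MvPolynomial ((Fin n × Fin n) ⊕ (Fin n × Fin n)) ℂ ⧸
        Ideal.span (Set.range fun p : Fin n × Fin n =>
          (genX n * genY n - genY n * genX n) p.1 p.2)) ⧸ P)
  let K := AlgebraicClosure L
  let ψ : _ ⧸ P →ₐ[ℂ] K := (IsScalarTower.toAlgHom ℂ L K).comp (IsScalarTower.toAlgHom ℂ (_ ⧸ P) L)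
  have hψ : Function.Injective ψ :=
    (algebraMap L K).injective.comp (IsFractionRing.injective (_ ⧸ P) L)
  let φ : MvPolynomial ((Fin n × Fin n) ⊕ (Fin n × Fin n)) ℂ →ₐ[ℂ] K :=
    ψ.comp ((Ideal.Quotient.mkₐ ℂ P).comp (Ideal.Quotient.mkₐ ℂ _))
  have hcomm : (genX n).map φ * (genY n).map φ = (genY n).map φ * (genX n).map φ := by
    rw [← Matrix.map_mul, ← Matrix.map_mul]
    ext i j
    rw [Matrix.map_apply, Matrix.map_apply, ← sub_eq_zero, ← map_sub, ← Matrix.sub_apply]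
    change ψ (Ideal.Quotient.mk P (Ideal.Quotient.mk _ _)) = 0
    have h0 : (genX n * genY n - genY n * genX n) i j ∈
        Ideal.span (Set.range fun p : Fin n × Fin n =>
          (genX n * genY n - genY n * genX n) p.1 p.2) := Ideal.subset_span ⟨(i, j), rfl⟩
    rw [Ideal.Quotient.eq_zero_iff_mem.mpr h0, map_zero, map_zero]
  obtain ⟨T, hT, hX, hY⟩ := aux_upper n _ _ hcomm
  have hmem : ∀ s, φ s ∈ IntermediateField.adjoin ℂ (T : Set K) := by
    intro s
    induction s using MvPolynomial.induction_on with
    | C a =>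
      have : φ (MvPolynomial.C a) = algebraMap ℂ K a := φ.commutes a
      rw [this]
      exact IntermediateField.algebraMap_mem _ a
    | add p q hp hq => rw [map_add]; exact add_mem hp hq
    | mul_X p v hp =>
      rw [map_mul]
      refine mul_mem hp ?_
      rcases v with ⟨i, j⟩ | ⟨i, j⟩
      · exact hX i j
      · exact hY i j
  have hmem' : ∀ a, ψ a ∈ (IntermediateField.adjoin ℂ (T : Set K)).toSubalgebra := by
    intro a
    obtain ⟨b, rfl⟩ := Ideal.Quotient.mk_surjective a
    obtain ⟨s, rfl⟩ := Ideal.Quotient.mk_surjective b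
    exact hmem s
  let χ : _ ⧸ P →ₐ[ℂ] IntermediateField.adjoin ℂ (T : Set K) := ψ.codRestrict _ hmem'
  have hχ : Function.Injective χ := fun a b h => hψ (congrArg Subtype.val h)
  exact ((trdeg_le_of_injective χ hχ).trans (aux_trdeg_adjoin T)).trans (Nat.cast_le.mpr hT)

/-- STATEMENT 8: the commuting scheme of pairs of `n × n` matrices, i.e. the zero
scheme of the entries of `X·Y − Y·X`, has Krull dimension `n² + n`. -/
theorem stmt_8 (n : ℕ) (hn : 1 ≤ n) :
    ringKrullDim
      (MvPolynomial ((Fin n × Fin n) ⊕ (Fin n × Fin n)) ℂ ⧸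
        Ideal.span (Set.range fun p : Fin n × Fin n =>
          (genX n * genY n - genY n * genX n) p.1 p.2)) = (n ^ 2 + n : ℕ) := by
  exact le_antisymm (aux_dim_upper n) (aux_lower n hn)
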